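/- arXiv:1504.02743 — 5 statements merged into one kernel-verified Lean document; each statement's English description precedes it below -/
import Mathlib

section
/- Semantic compactness of the STIT imagination logic: if every finite subset of a set Θ of sentences has a model (is satisfied at some moment-history pair of some imagination model), then Θ itself has a model. -/
set_option maxHeartbeats 1000000

/-! Syntax: countably many variables (indexed by ℕ), Booleans (⊥, →),
    modalities `S` (box), `[c]_a` (cstit) and `I_a` (imag) for agents in `Agent`. -/

inductive Form (Agent : Type) : Type
  | var : ℕ → Form Agent
  | fls : Form Agent
  | imp : Form Agent → Form Agent → Form Agent
  | box : Form Agent → Form Agent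
  | cstit : Agent → Form Agent → Form Agent
  | imag : Agent → Form Agent → Form Agent

namespace Form

variable {Agent : Type}

def neg (A : Form Agent) : Form Agent := A.imp .fls

def conj (A B : Form Agent) : Form Agent := (A.imp B.neg).neg

def fiff (A B : Form Agent) : Form Agent := (A.imp B).conj (B.imp A)

/-- `P`, the dual of `S`. -/
def pos (A : Form Agent) : Form Agent := A.neg.box.neg

/-- The dual of `[c]_a`. -/
def posC (a : Agent) (A : Form Agent) : Form Agent := (Form.cstit a A.neg).neg

def verum : Form Agent := (Form.fls : Form Agent).neg

end Form

def listConj {Agent : Type} : List (Form Agent) → Form Agent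
  | [] => Form.verum
  | A :: l => A.conj (listConj l)

/-- Propositional tautologies: true under every Boolean valuation treating
    variables and modalized formulas as atoms. -/
def Tautology {Agent : Type} (A : Form Agent) : Prop :=
  ∀ v : Form Agent → Prop, ¬ v .fls → (∀ B C : Form Agent, v (B.imp C) ↔ (v B → v C)) → v A

/-- The Hilbert system L: (A0) tautologies, (A1) S is S5, (A2) each [c]_a is S5,
    (A3) SA → [c]_aA, (A4) independence axiom, (A5) imagination-as-action axiom;
    rules: modus ponens, S-necessitation, replacement of equivalents under I_a. -/
inductive Prov {Agent : Type} : Form Agent → Prop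
  | taut {A : Form Agent} : Tautology A → Prov A
  | sK (A B : Form Agent) : Prov ((A.imp B).box.imp (A.box.imp B.box))
  | sT (A : Form Agent) : Prov (A.box.imp A)
  | s5 (A : Form Agent) : Prov (A.pos.imp A.pos.box)
  | cK (a : Agent) (A B : Form Agent) :
      Prov ((Form.cstit a (A.imp B)).imp ((Form.cstit a A).imp (Form.cstit a B)))
  | cT (a : Agent) (A : Form Agent) : Prov ((Form.cstit a A).imp A)
  | c5 (a : Agent) (A : Form Agent) :
      Prov ((Form.posC a A).imp (Form.cstit a (Form.posC a A)))
  | a3 (a : Agent) (A : Form Agent) : Prov (A.box.imp (Form.cstit a A))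
  | a4 (l : List (Agent × Form Agent)) (hne : l ≠ []) (hnd : (l.map Prod.fst).Nodup) :
      Prov ((listConj (l.map fun p => (Form.cstit p.1 p.2).pos)).imp
        (listConj (l.map fun p => Form.cstit p.1 p.2)).pos)
  | a5 (a : Agent) (A : Form Agent) :
      Prov ((Form.imag a A).imp ((Form.cstit a (Form.imag a A)).conj (Form.imag a A).box.neg))
  | mp {A B : Form Agent} : Prov (A.imp B) → Prov A → Prov B
  | necS {A : Form Agent} : Prov A → Prov A.box
  | reI (a : Agent) {A B : Form Agent} :
      Prov (A.fiff B) → Prov ((Form.imag a A).fiff (Form.imag a B))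

/-- A set is L-consistent iff no finite conjunction of its members derives a contradiction. -/
def Consistent {Agent : Type} (Γ : Set (Form Agent)) : Prop :=
  ¬ ∃ l : List (Form Agent), (∀ A ∈ l, A ∈ Γ) ∧ Prov ((listConj l).imp .fls)

/-- L-maxiconsistent: L-consistent and maximal among L-consistent sets. -/
def MaxConsistent {Agent : Type} (w : Set (Form Agent)) : Prop :=
  Consistent w ∧ ∀ Γ : Set (Form Agent), Consistent Γ → w ⊆ Γ → Γ = w

/-- Σ = {¬p : p ∈ Var} ∪ {SA ↔ A} ∪ {[c]_aA ↔ A}. -/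
def SigmaSet (Agent : Type) : Set (Form Agent) :=
  {φ | (∃ n : ℕ, φ = (Form.var n : Form Agent).neg) ∨
       (∃ A : Form Agent, φ = A.box.fiff A) ∨
       (∃ (a : Agent) (A : Form Agent), φ = (Form.cstit a A).fiff A)}

/-! Semantics: imagination models and satisfaction. -/

/-- The raw data of an imagination model (frame conditions separated out below). -/
structure PreModel (Agent : Type) where
  Tree : Type
  le : Tree → Tree → Prop
  Choice : Tree → Agent → Set (Set (Set Tree))
  N : Agent → Tree → Set Tree → Set (Set (Tree × Set Tree))
  V : ℕ → Set (Tree × Set Tree)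

namespace PreModel

variable {Agent : Type} (M : PreModel Agent)

/-- Histories are maximal chains. -/
def IsHist (h : Set M.Tree) : Prop := IsMaxChain M.le h

/-- The set of histories passing through `m`. -/
def Hm (m : M.Tree) : Set (Set M.Tree) := {h | M.IsHist h ∧ m ∈ h}

/-- `Choice^m_a(h)`: the histories lying in the same choice cell as `h` at `m`. -/
def Cell (m : M.Tree) (a : Agent) (h : Set M.Tree) : Set (Set M.Tree) :=
  {h' | ∃ e ∈ M.Choice m a, h ∈ e ∧ h' ∈ e}

/-- Satisfaction at a moment-history pair. -/
def Sat : Form Agent → M.Tree → Set M.Tree → Prop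
  | .var n, m, h => (m, h) ∈ M.V n
  | .fls, _, _ => False
  | .imp A B, m, h => Sat A m h → Sat B m h
  | .box A, m, h => ∀ h' ∈ M.Hm m, Sat A m h'
  | .cstit a A, m, h => ∀ h' ∈ M.Cell m a h, Sat A m h'
  | .imag a A, m, h =>
      (∀ h' ∈ M.Cell m a h,
        {p : M.Tree × Set M.Tree | M.IsHist p.2 ∧ p.1 ∈ p.2 ∧ Sat A p.1 p.2} ∈ M.N a m h') ∧
      (∃ h'' ∈ M.Hm m,
        {p : M.Tree × Set M.Tree | M.IsHist p.2 ∧ p.1 ∈ p.2 ∧ Sat A p.1 p.2} ∉ M.N a m h'')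

end PreModel

/-- An imagination model: the raw data together with all frame conditions. -/
structure IModel (Agent : Type) extends PreModel Agent where
  tree_nonempty : Nonempty Tree
  le_refl : ∀ x, le x x
  le_antisymm : ∀ x y, le x y → le y x → x = y
  le_trans : ∀ x y z, le x y → le y z → le x z
  lower_bound : ∀ m1 m2, ∃ m, le m m1 ∧ le m m2
  past_linear : ∀ m m1 m2, le m1 m → le m2 m → le m1 m2 ∨ le m2 m1
  choice_cells_nonempty : ∀ m a, ∀ e ∈ Choice m a, e.Nonempty
  choice_cover : ∀ m a, ⋃₀ (Choice m a) = toPreModel.Hm m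
  choice_disjoint : ∀ m a, ∀ e ∈ Choice m a, ∀ e' ∈ Choice m a, e ≠ e' → e ∩ e' = ∅
  no_choice_between_undivided : ∀ m a, ∀ e ∈ Choice m a, ∀ h h',
      h ∈ toPreModel.Hm m → h' ∈ toPreModel.Hm m → h ∈ e →
      (∃ m', (le m m' ∧ m ≠ m') ∧ m' ∈ h ∧ m' ∈ h') → h' ∈ e
  independence : ∀ m (f : Agent → Set (Set Tree)), (∀ a, f a ∈ Choice m a) →
      (⋂ a, f a).Nonempty

/-! The canonical model. -/

section Canonical

variable {Agent : Type}

/-- wRw' iff {A : SA ∈ w} ⊆ w'. -/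
def CanR (w w' : Set (Form Agent)) : Prop := ∀ A : Form Agent, A.box ∈ w → A ∈ w'

/-- w ≃_a w' iff {A : [c]_aA ∈ w} ⊆ w'. -/
def CanC (a : Agent) (w w' : Set (Form Agent)) : Prop :=
  ∀ A : Form Agent, Form.cstit a A ∈ w → A ∈ w'

/-- The R-class of a maxiconsistent set. -/
def RCls (w : Set (Form Agent)) : Set (Set (Form Agent)) :=
  {w' | MaxConsistent w' ∧ CanR w w'}

/-- Ξ: the set of R-equivalence classes. -/
def Xi (Agent : Type) : Set (Set (Set (Form Agent))) :=
  {X | ∃ w, MaxConsistent w ∧ X = RCls w}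

/-- E(X,a): the ≃_a-equivalence classes within X. -/
def ECls (X : Set (Set (Form Agent))) (a : Agent) : Set (Set (Set (Form Agent))) :=
  {e | ∃ w ∈ X, e = {w' ∈ X | CanC a w w'}}

/-- Raw canonical points: the fresh root `none`, classes `some (inl X)`, worlds `some (inr w)`. -/
def CPoint (Agent : Type) : Type := Option (Set (Set (Form Agent)) ⊕ Set (Form Agent))

/-- Tree = {0} ∪ Ξ ∪ W. -/
def CTreeSet (Agent : Type) : Set (CPoint Agent) :=
  {x | x = none ∨ (∃ X ∈ Xi Agent, x = some (Sum.inl X)) ∨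
       (∃ w, MaxConsistent w ∧ x = some (Sum.inr w))}

def CTree (Agent : Type) : Type := {x : CPoint Agent // x ∈ CTreeSet Agent}

/-- x ≤ y iff x = y or y ∈ x or x = 0. -/
def CLe (x y : CTree Agent) : Prop :=
  x = y ∨ (∃ X w, x.1 = some (Sum.inl X) ∧ y.1 = some (Sum.inr w) ∧ w ∈ X) ∨ x.1 = none

/-- h_w = {0, X, w}. -/
def CHistX (X : Set (Set (Form Agent))) (w : Set (Form Agent)) : Set (CTree Agent) :=
  {x | x.1 = none ∨ x.1 = some (Sum.inl X) ∨ x.1 = some (Sum.inr w)}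

def IsClsMoment (m : CTree Agent) : Prop := ∃ X, m.1 = some (Sum.inl X)

/-- The canonical choice function: vacuous outside Ξ, induced by E(X,a) at X ∈ Ξ. -/
def CChoice (m : CTree Agent) (a : Agent) : Set (Set (Set (CTree Agent))) :=
  {H | (¬ IsClsMoment m ∧ H = {h | IsMaxChain CLe h ∧ m ∈ h}) ∨
       (∃ X, m.1 = some (Sum.inl X) ∧ ∃ e ∈ ECls X a,
          H = {h | ∃ w ∈ e, h = CHistX X w})}

/-- Ext(A): {X/h_w : w ∈ X ∈ Ξ, A ∈ w}, augmented by all pairs m/h_w with m ∉ Ξ, m ∈ h_w,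
    in case A belongs to the maxiconsistent extension of Σ. -/
def CExt (A : Form Agent) : Set (CTree Agent × Set (CTree Agent)) :=
  {p | ∃ X w, X ∈ Xi Agent ∧ w ∈ X ∧ A ∈ w ∧
        p.1.1 = some (Sum.inl X) ∧ p.2 = CHistX X w} ∪
  {p | (∃ w0, MaxConsistent w0 ∧ SigmaSet Agent ⊆ w0 ∧ A ∈ w0) ∧
        ∃ X w, X ∈ Xi Agent ∧ w ∈ X ∧ p.2 = CHistX X w ∧
          ¬ IsClsMoment p.1 ∧ p.1 ∈ p.2}

/-- N_a(X/h_w) = {Ext A : I_aA ∈ w}; empty at moments outside Ξ. -/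
def CN (a : Agent) (m : CTree Agent) (h : Set (CTree Agent)) :
    Set (Set (CTree Agent × Set (CTree Agent))) :=
  {P | ∃ X w, m.1 = some (Sum.inl X) ∧ X ∈ Xi Agent ∧ w ∈ X ∧ h = CHistX X w ∧
        ∃ A, Form.imag a A ∈ w ∧ P = CExt A}

/-- V(p) = {X/h_w : w ∈ X ∈ Ξ, p ∈ w}. -/
def CV (Agent : Type) (n : ℕ) : Set (CTree Agent × Set (CTree Agent)) :=
  {p | ∃ X w, X ∈ Xi Agent ∧ w ∈ X ∧ Form.var n ∈ w ∧
        p.1.1 = some (Sum.inl X) ∧ p.2 = CHistX X w}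

/-- The canonical model (raw data). -/
def CanModel (Agent : Type) : PreModel Agent where
  Tree := CTree Agent
  le := CLe
  Choice := CChoice
  N := CN
  V := CV Agent

/-- The canonical moment corresponding to a class X ∈ Ξ. -/
def clsMoment {X : Set (Set (Form Agent))} (hX : X ∈ Xi Agent) : CTree Agent :=
  ⟨some (Sum.inl X), Or.inr (Or.inl ⟨X, hX, rfl⟩)⟩

end Canonical

namespace Cpt

structure Pt (Agent : Type) where
  M : IModel Agent
  m : M.Tree
  h : Set M.Tree
  hh : h ∈ M.toPreModel.Hm m

variable {Agent : Type}

def T (p : Pt Agent) (A : Form Agent) : Prop := p.M.toPreModel.Sat A p.m p.h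

theorem T_imp (p : Pt Agent) (A B : Form Agent) : T p (A.imp B) ↔ (T p A → T p B) := Iff.rfl
theorem T_fls (p : Pt Agent) : ¬ T p .fls := fun h => h
theorem T_neg (p : Pt Agent) (A : Form Agent) : T p A.neg ↔ ¬ T p A := Iff.rfl

theorem cell_hm (M : IModel Agent) {m a h h'} (H : h' ∈ M.toPreModel.Cell m a h) :
    h' ∈ M.toPreModel.Hm m := by
  obtain ⟨e, he, _, h2⟩ := H
  rw [← M.choice_cover m a]
  exact ⟨e, he, h2⟩

theorem cell_refl (M : IModel Agent) {m h} (a : Agent) (H : h ∈ M.toPreModel.Hm m) :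
    h ∈ M.toPreModel.Cell m a h := by
  rw [← M.choice_cover m a] at H
  obtain ⟨e, he, h2⟩ := H
  exact ⟨e, he, h2, h2⟩

theorem cell_symm (M : IModel Agent) {m a h h'} (H : h' ∈ M.toPreModel.Cell m a h) :
    h ∈ M.toPreModel.Cell m a h' := by
  obtain ⟨e, he, h1, h2⟩ := H
  exact ⟨e, he, h2, h1⟩

theorem cell_trans (M : IModel Agent) {m a h h' h''} (H : h' ∈ M.toPreModel.Cell m a h)
    (H' : h'' ∈ M.toPreModel.Cell m a h') : h'' ∈ M.toPreModel.Cell m a h := by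
  obtain ⟨e, he, h1, h2⟩ := H
  obtain ⟨e', he', h1', h2'⟩ := H'
  have : e = e' := by
    by_contra hne
    have := M.choice_disjoint m a e he e' he' hne
    have h3 : h' ∈ e ∩ e' := ⟨h2, h1'⟩
    rw [this] at h3
    exact h3
  subst this
  exact ⟨e, he, h1, h2'⟩

inductive RelS : Pt Agent → Pt Agent → Prop
  | mk (M : IModel Agent) (m) (h h') (hh) (hh') : RelS ⟨M, m, h, hh⟩ ⟨M, m, h', hh'⟩

inductive RelC (a : Agent) : Pt Agent → Pt Agent → Prop
  | mk (M : IModel Agent) (m) (h h') (hh) (hh') (H : h' ∈ M.toPreModel.Cell m a h) :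
      RelC a ⟨M, m, h, hh⟩ ⟨M, m, h', hh'⟩

/-- S5 operator. -/
structure S5 (op : Form Agent → Form Agent) (R : Pt Agent → Pt Agent → Prop) : Prop where
  refl : ∀ p, R p p
  symm : ∀ p q, R p q → R q p
  trans : ∀ p q r, R p q → R q r → R p r
  sat : ∀ p A, T p (op A) ↔ ∀ q, R p q → T q A

theorem s5S : S5 (Form.box (Agent := Agent)) RelS where
  refl p := ⟨_, _, _, _, _, _⟩
  symm p q h := by cases h; exact ⟨_, _, _, _, _, _⟩
  trans p q r h h' := by cases h; cases h'; exact ⟨_, _, _, _, _, _⟩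
  sat p A := by
    constructor
    · intro h q hq
      cases hq with
      | mk M m h1 h2 hh hh' => exact h _ hh'
    · intro h h' hh'
      exact h ⟨p.M, p.m, h', hh'⟩ ⟨_, _, _, _, _, _⟩

theorem s5C (a : Agent) : S5 (Form.cstit a) (RelC a) where
  refl p := ⟨_, _, _, _, _, _, cell_refl _ _ p.hh⟩
  symm p q h := by cases h with | mk M m h h' hh hh' H => exact ⟨_, _, _, _, _, _, cell_symm _ H⟩
  trans p q r h h' := by
    cases h with | mk M m h1 h2 hh hh' H =>
    cases h' with | mk _ _ _ h3 _ hh3 H3 => exact ⟨_, _, _, _, _, _, cell_trans _ H H3⟩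
  sat p A := by
    constructor
    · intro h q hq
      cases hq with
      | mk M m h1 h2 hh hh' H => exact h _ H
    · intro h h' hh'
      exact h ⟨p.M, p.m, h', cell_hm _ hh'⟩ ⟨_, _, _, _, _, _, hh'⟩

def FS (Γ : Set (Form Agent)) : Prop :=
  ∀ F : Set (Form Agent), F ⊆ Γ → F.Finite → ∃ p, ∀ A ∈ F, T p A

def W (Agent : Type) : Type :=
  {w : Set (Form Agent) // FS w ∧ ∀ A, A ∈ w ∨ A.neg ∈ w}

instance : Membership (Form Agent) (W Agent) := ⟨fun w A => A ∈ w.1⟩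

theorem lind {Γ : Set (Form Agent)} (h : FS Γ) : ∃ w : W Agent, ∀ A ∈ Γ, A ∈ w := by
  let tr : Form Agent → Set (Pt Agent) := fun A => {p | T p A}
  have hne : (Filter.generate (tr '' Γ)).NeBot := by
    rw [Filter.generate_neBot_iff]
    intro t ht htf
    obtain ⟨F, hF, hFf, rfl⟩ := Set.exists_subset_image_finite_and.1 ⟨t, ht, htf, rfl⟩
    obtain ⟨p, hp⟩ := h F hF hFf
    refine ⟨p, ?_⟩
    rintro _ ⟨A, hA, rfl⟩
    exact hp A hA
  let U := Ultrafilter.of (Filter.generate (tr '' Γ))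
  have hU := Ultrafilter.of_le (Filter.generate (tr '' Γ))
  refine ⟨⟨{A | tr A ∈ U}, ?_, ?_⟩, ?_⟩
  · intro F hF hFf
    have : (⋂ A ∈ F, tr A) ∈ U := (Filter.biInter_mem hFf).2 hF
    obtain ⟨p, hp⟩ := Ultrafilter.nonempty_of_mem this
    exact ⟨p, fun A hA => Set.mem_iInter₂.1 hp A hA⟩
  · intro A
    exact Ultrafilter.mem_or_compl_mem U (tr A)
  · intro A hA
    exact hU (Filter.mem_generate_of_mem ⟨A, hA, rfl⟩)

theorem ptW (p : Pt Agent) : ∃ w : W Agent, ∀ A, A ∈ w ↔ T p A :=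
  ⟨⟨{A | T p A}, fun F hF _ => ⟨p, hF⟩, fun A => Classical.em _⟩, fun _ => Iff.rfl⟩

theorem W.cl (w : W Agent) (F : Set (Form Agent)) (hF : F.Finite) (hw : ∀ B ∈ F, B ∈ w)
    (A : Form Agent) (h : ∀ p, (∀ B ∈ F, T p B) → T p A) : A ∈ w := by
  rcases w.2.2 A with h1 | h1
  · exact h1
  · exfalso
    obtain ⟨p, hp⟩ := w.2.1 (insert A.neg F)
      (by rintro B (rfl | hB); exacts [h1, hw B hB]) (hF.insert _)
    exact hp A.neg (by simp) (h p fun B hB => hp B (by simp [hB]))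

theorem W.cl1 (w : W Agent) {B A : Form Agent} (hw : B ∈ w)
    (h : ∀ p, T p B → T p A) : A ∈ w :=
  w.cl {B} (by simp) (by simpa using hw) A (fun p hp => h p (hp B rfl))

theorem W.fls (w : W Agent) : Form.fls ∉ w := fun h => by
  obtain ⟨p, hp⟩ := w.2.1 {.fls} (Set.singleton_subset_iff.2 h) (by simp)
  exact hp _ rfl

theorem W.neg (w : W Agent) (A : Form Agent) : A.neg ∈ w ↔ A ∉ w := by
  constructor
  · intro h h'
    obtain ⟨p, hp⟩ := w.2.1 {A, A.neg} (by rintro B (rfl | rfl); exacts [h', h]) (by simp)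
    exact hp A.neg (by simp) (hp A (by simp))
  · intro h
    exact (w.2.2 A).resolve_left h

theorem W.imp (w : W Agent) (A B : Form Agent) : A.imp B ∈ w ↔ (A ∈ w → B ∈ w) := by
  constructor
  · intro h h'
    exact w.cl {A, A.imp B} (by simp) (by rintro C (rfl | rfl); exacts [h', h]) B
      fun p hp => hp (A.imp B) (by simp) (hp A (by simp))
  · intro h
    by_cases hA : A ∈ w
    · exact w.cl1 (h hA) fun p hp _ => hp
    · exact w.cl1 ((w.neg A).2 hA) fun p hp h => absurd h hp

section op
variable {op : Form Agent → Form Agent} {R : Pt Agent → Pt Agent → Prop} (s : S5 op R)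
include s

theorem op_T (w : W Agent) {A} (h : op A ∈ w) : A ∈ w :=
  w.cl1 h fun p hp => (s.sat p A).1 hp p (s.refl p)

theorem op_4 (w : W Agent) {A} (h : op A ∈ w) : op (op A) ∈ w :=
  w.cl1 h fun p hp => (s.sat _ _).2 fun q hq => (s.sat _ _).2 fun r hr =>
    (s.sat _ _).1 hp r (s.trans _ _ _ hq hr)

theorem op_5 (w : W Agent) {A} (h : op A ∉ w) : op (op A).neg ∈ w :=
  w.cl1 ((w.neg _).2 h) fun p hp => (s.sat _ _).2 fun q hq hq' => hp <| (s.sat _ _).2 fun r hr =>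
    (s.sat _ _).1 hq' r (s.trans _ _ _ (s.symm _ _ hq) hr)

theorem op_eq (w w' : W Agent) (h : ∀ B, op B ∈ w → B ∈ w') (B) : op B ∈ w ↔ op B ∈ w' := by
  constructor
  · intro hB
    exact h _ (op_4 s w hB)
  · intro hB
    by_contra hn
    exact (w'.neg _).1 (h _ (op_5 s w hn)) hB

theorem op_ex (w : W Agent) {A} (h : op A ∉ w) :
    ∃ w' : W Agent, A ∉ w' ∧ ∀ B, op B ∈ w ↔ op B ∈ w' := by
  have : FS ({B | op B ∈ w} ∪ {A.neg}) := by
    intro F hF hFf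
    obtain ⟨p, hp⟩ := w.2.1 (insert (op A).neg (op '' (F ∩ {B | op B ∈ w}))) (by
      rintro C (rfl | ⟨B, hB, rfl⟩)
      · exact (w.neg _).2 h
      · exact hB.2) (((hFf.inter_of_left _).image _).insert _)
    have h1 := hp (op A).neg (by simp)
    rw [T_neg, s.sat] at h1
    push Not at h1
    obtain ⟨q, hq, hqA⟩ := h1
    refine ⟨q, fun B hB => ?_⟩
    rcases hF hB with h2 | h2
    · exact (s.sat _ _).1 (hp (op B) (Or.inr ⟨B, ⟨hB, h2⟩, rfl⟩)) q hq
    · rw [Set.mem_singleton_iff.1 h2]; exact hqA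
  obtain ⟨w', hw'⟩ := lind this
  exact ⟨w', (w'.neg _).1 (hw' _ (by simp)), op_eq s w w' fun B hB => hw' B (Or.inl hB)⟩
end op

def qf (w : W Agent) : Set (Form Agent) := {A | A.box ∈ w}
def kf (a : Agent) (w : W Agent) : Set (Form Agent) := {A | Form.cstit a A ∈ w}

theorem T_conj (p : Pt Agent) (A B : Form Agent) : T p (A.conj B) ↔ T p A ∧ T p B := by
  simp only [Form.conj, T_neg, T_imp]; tauto

theorem T_listConj (p : Pt Agent) (l : List (Form Agent)) :
    T p (listConj l) ↔ ∀ A ∈ l, T p A := by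
  induction l with
  | nil => simp [listConj, Form.verum, T_neg, T_fls]
  | cons A l ih => simp [listConj, T_conj, ih]

theorem indep [Fintype Agent] (w0 : W Agent) (g : Agent → W Agent)
    (hg : ∀ a, qf (g a) = qf w0) :
    ∃ w : W Agent, qf w = qf w0 ∧ ∀ a, kf a w = kf a (g a) := by
  classical
  have : FS ({B | B.box ∈ w0} ∪ {B | ∃ a, Form.cstit a B ∈ g a}) := by
    intro F hF hFf
    let c : Agent → Form Agent := fun a =>
      listConj (hFf.toFinset.filter (fun B => Form.cstit a B ∈ g a)).toList
    have hc : ∀ a p, T p (c a) ↔ ∀ B ∈ F, Form.cstit a B ∈ g a → T p B := by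
      intro a p; simp [c, T_listConj]
    have hcg : ∀ a, Form.cstit a (c a) ∈ g a := by
      intro a
      refine (g a).cl (Form.cstit a '' (F ∩ {B | Form.cstit a B ∈ g a}))
        ((hFf.inter_of_left _).image _) (by rintro _ ⟨B, hB, rfl⟩; exact hB.2) _ ?_
      intro p hp
      refine ((s5C a).sat _ _).2 fun q hq => (hc a q).2 fun B hB hB' => ?_
      exact ((s5C a).sat _ _).1 (hp _ ⟨B, ⟨hB, hB'⟩, rfl⟩) q hq
    have hpos : ∀ a, (Form.cstit a (c a)).pos ∈ w0 := by
      intro a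
      rw [Form.pos, W.neg]
      intro hn
      have h2 : (Form.cstit a (c a)).neg ∈ qf w0 := hn
      rw [← hg a] at h2
      exact ((g a).neg _).1 (op_T s5S _ h2) (hcg a)
    obtain ⟨p, hp⟩ := w0.2.1 (Form.box '' (F ∩ {B | B.box ∈ w0}) ∪
        Set.range (fun a => (Form.cstit a (c a)).pos)) (by
      rintro C (⟨B, hB, rfl⟩ | ⟨a, rfl⟩)
      · exact hB.2
      · exact hpos a) (((hFf.inter_of_left _).image _).union (Set.finite_range _))
    obtain ⟨M, m, h, hh⟩ := p
    have h1 : ∀ a, ∃ e ∈ M.Choice m a, ∀ h' ∈ e, M.toPreModel.Sat (c a) m h' := by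
      intro a
      have h2 := hp _ (Or.inr ⟨a, rfl⟩)
      change ¬ T _ (Form.cstit a (c a)).neg.box at h2
      rw [s5S.sat] at h2
      push Not at h2
      obtain ⟨q, hq, hq2⟩ := h2
      rw [T_neg, not_not] at hq2
      cases hq with | mk _ _ _ h' _ hh' =>
      obtain ⟨e, he, h3, h4⟩ := cell_refl M a hh'
      exact ⟨e, he, fun h'' hh'' => hq2 h'' ⟨e, he, h3, hh''⟩⟩
    choose f hf hf2 using h1
    by_cases hE : Nonempty Agent
    · obtain ⟨a0⟩ := hE
      obtain ⟨h', hh'⟩ := M.independence m f hf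
      rw [Set.mem_iInter] at hh'
      have hm : h' ∈ M.toPreModel.Hm m := by
        rw [← M.choice_cover m a0]; exact ⟨_, hf a0, hh' a0⟩
      refine ⟨⟨M, m, h', hm⟩, fun B hB => ?_⟩
      rcases hF hB with h2 | ⟨a, h2⟩
      · exact hp _ (Or.inl ⟨B, ⟨hB, h2⟩, rfl⟩) h' hm
      · exact (hc a ⟨M, m, h', hm⟩).1 (hf2 a h' (hh' a)) B hB h2
    · refine ⟨⟨M, m, h, hh⟩, fun B hB => ?_⟩
      rcases hF hB with h2 | ⟨a, h2⟩
      · exact hp _ (Or.inl ⟨B, ⟨hB, h2⟩, rfl⟩) h hh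
      · exact absurd ⟨a⟩ hE
  obtain ⟨w, hw⟩ := lind this
  refine ⟨w, ?_, fun a => ?_⟩
  · ext B
    exact (op_eq s5S w0 w (fun B hB => hw B (Or.inl hB)) B).symm
  · ext B
    exact (op_eq (s5C a) (g a) w (fun B hB => hw B (Or.inr ⟨a, hB⟩)) B).symm

/-! The tree. -/

inductive Tr (Agent : Type) : Type
  | root : Tr Agent
  | cls : Set.range (qf (Agent := Agent)) → Tr Agent
  | leaf : W Agent → Tr Agent

def qr (w : W Agent) : Set.range (qf (Agent := Agent)) := ⟨qf w, w, rfl⟩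

theorem qr_surj (x : Set.range (qf (Agent := Agent))) : ∃ w, qr w = x := by
  obtain ⟨_, w, rfl⟩ := x; exact ⟨w, rfl⟩

theorem qr_eq {w w' : W Agent} : qr w = qr w' ↔ qf w = qf w' := Subtype.ext_iff

def tle : Tr Agent → Tr Agent → Prop
  | .root, _ => True
  | .cls x, .cls y => x = y
  | .cls x, .leaf w => qr w = x
  | .leaf w, .leaf v => w = v
  | _, _ => False

def Hh (w : W Agent) : Set (Tr Agent) := {.root, .cls (qr w), .leaf w}

theorem mem_Hh (w : W Agent) (x : Tr Agent) : x ∈ Hh w ↔ tle x (.leaf w) := by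
  cases x <;> simp [Hh, tle, eq_comm]

theorem leaf_mem_Hh (w v : W Agent) : .leaf v ∈ Hh w ↔ v = w := by simp [Hh]
theorem cls_mem_Hh (w : W Agent) (x) : .cls x ∈ Hh w ↔ x = qr w := by simp [Hh]
theorem root_mem_Hh (w : W Agent) : .root ∈ Hh w := by simp [Hh]

theorem Hh_inj {w v : W Agent} (h : Hh w = Hh v) : w = v := by
  have := (leaf_mem_Hh w w).2 rfl
  rw [h] at this
  exact (leaf_mem_Hh _ _).1 this

theorem chain_Hh (w : W Agent) : IsChain tle (Hh w) := by
  intro x hx y hy _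
  cases x <;> cases y <;> simp_all [Hh, tle]

theorem sub_of_leaf {h : Set (Tr Agent)} (hc : IsChain tle h) {w} (hw : .leaf w ∈ h) :
    h ⊆ Hh w := by
  intro x hx
  rw [mem_Hh]
  by_cases hxw : x = .leaf w
  · subst hxw; simp [tle]
  · rcases hc hx hw hxw with h1 | h1
    · exact h1
    · cases x <;> simp_all [tle]

theorem hist_iff [Nonempty (W Agent)] (h : Set (Tr Agent)) :
    IsMaxChain tle h ↔ ∃ w, h = Hh w := by
  constructor
  · intro hm
    suffices ∃ w, h ⊆ Hh w by
      obtain ⟨w, hw⟩ := this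
      exact ⟨w, hm.2 (chain_Hh w) hw⟩
    by_cases h1 : ∃ w, .leaf w ∈ h
    · obtain ⟨w, hw⟩ := h1
      exact ⟨w, sub_of_leaf hm.1 hw⟩
    · by_cases h2 : ∃ x, .cls x ∈ h
      · obtain ⟨x, hx⟩ := h2
        obtain ⟨w, rfl⟩ := qr_surj x
        refine ⟨w, fun y hy => ?_⟩
        cases y with
        | root => exact root_mem_Hh w
        | leaf v => exact absurd ⟨v, hy⟩ h1
        | cls y =>
          rw [cls_mem_Hh]
          by_contra hne
          rcases hm.1 hy hx (by simpa using hne) with h3 | h3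
          · exact hne h3
          · exact hne h3.symm
      · obtain ⟨w⟩ := ‹Nonempty (W Agent)›
        refine ⟨w, fun y hy => ?_⟩
        cases y with
        | root => exact root_mem_Hh w
        | leaf v => exact absurd ⟨v, hy⟩ h1
        | cls y => exact absurd ⟨y, hy⟩ h2
  · rintro ⟨w, rfl⟩
    refine ⟨chain_Hh w, fun t ht hs => ?_⟩
    exact hs.antisymm (sub_of_leaf ht (hs ((leaf_mem_Hh w w).2 rfl)))

def cell (a : Agent) (w : W Agent) : Set (Set (Tr Agent)) :=
  Hh '' {w' | qr w' = qr w ∧ kf a w' = kf a w}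

def ch : Tr Agent → Agent → Set (Set (Set (Tr Agent)))
  | .cls x, a => {e | ∃ w, qr w = x ∧ e = cell a w}
  | m, _ => {{h | IsMaxChain tle h ∧ m ∈ h}}

abbrev pre (Agent : Type) : PreModel Agent where
  Tree := Tr Agent
  le := tle
  Choice := ch
  N a m h := {P | ∃ w, m = .cls (qr w) ∧ h = Hh w ∧ ∃ A, Form.imag a A ∈ w ∧
    ∀ v, (Tr.cls (qr v), Hh v) ∈ P ↔ A ∈ v}
  V n := {p | ∃ w, p = (.cls (qr w), Hh w) ∧ Form.var n ∈ w}

theorem hm_cls [Nonempty (W Agent)] (x) (h : Set (Tr Agent)) :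
    h ∈ (pre Agent).Hm (.cls x) ↔ ∃ w, qr w = x ∧ h = Hh w := by
  change IsMaxChain tle h ∧ _ ↔ _
  rw [hist_iff]
  constructor
  · rintro ⟨⟨w, rfl⟩, h⟩
    exact ⟨w, ((cls_mem_Hh _ _).1 h).symm, rfl⟩
  · rintro ⟨w, rfl, rfl⟩
    exact ⟨⟨w, rfl⟩, (cls_mem_Hh _ _).2 rfl⟩

theorem hm_ne [Nonempty (W Agent)] (m : Tr Agent) : ((pre Agent).Hm m).Nonempty := by
  cases m with
  | root =>
    obtain ⟨w⟩ := ‹Nonempty (W Agent)›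
    exact ⟨Hh w, (hist_iff _).2 ⟨w, rfl⟩, root_mem_Hh w⟩
  | cls x =>
    obtain ⟨w, rfl⟩ := qr_surj x
    exact ⟨Hh w, (hist_iff _).2 ⟨w, rfl⟩, (cls_mem_Hh _ _).2 rfl⟩
  | leaf w => exact ⟨Hh w, (hist_iff _).2 ⟨w, rfl⟩, (leaf_mem_Hh _ _).2 rfl⟩

theorem ch_cases [Nonempty (W Agent)] (m : Tr Agent) (a : Agent) :
    ch m a = {(pre Agent).Hm m} ∨ ∃ x, m = .cls x := by
  cases m
  · exact Or.inl rfl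
  · exact Or.inr ⟨_, rfl⟩
  · exact Or.inl rfl

theorem ch_cls (x) (a : Agent) (e : Set (Set (Tr Agent))) :
    e ∈ ch (.cls x) a ↔ ∃ w, qr w = x ∧ e = cell a w := Iff.rfl

def can (Agent : Type) [Fintype Agent] [Nonempty (W Agent)] : IModel Agent where
  toPreModel := pre Agent
  tree_nonempty := ⟨Tr.root⟩
  le_refl x := by cases x <;> simp [pre, tle]
  le_antisymm x y := by cases x <;> cases y <;> simp [tle] <;> intros <;> simp_all
  le_trans x y z := by
    cases x <;> cases y <;> cases z <;> simp [pre, tle] <;> intros <;> simp_all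
  lower_bound _ _ := ⟨Tr.root, trivial, trivial⟩
  past_linear x y z := by
    cases x <;> cases y <;> cases z <;> simp [pre, tle] <;> intros <;> simp_all
  choice_cells_nonempty m a e he := by
    change e ∈ ch m a at he
    rcases ch_cases m a with h | ⟨x, rfl⟩
    · rw [h] at he
      rw [Set.mem_singleton_iff.1 he]
      exact hm_ne m
    · obtain ⟨w, rfl, rfl⟩ := (ch_cls _ _ _).1 he
      exact ⟨Hh w, w, ⟨rfl, rfl⟩, rfl⟩
  choice_cover m a := by
    change ⋃₀ (ch m a) = _
    rcases ch_cases m a with h | ⟨x, rfl⟩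
    · rw [h]; exact Set.sUnion_singleton _
    · ext h
      refine Iff.trans ?_ (hm_cls _ _).symm
      constructor
      · rintro ⟨e, ⟨w, rfl, rfl⟩, w', ⟨h1, _⟩, rfl⟩
        exact ⟨w', h1, rfl⟩
      · rintro ⟨w, rfl, rfl⟩
        exact ⟨_, ⟨w, rfl, rfl⟩, w, ⟨rfl, rfl⟩, rfl⟩
  choice_disjoint m a e he e' he' hne := by
    change e ∈ ch m a at he
    change e' ∈ ch m a at he'
    rcases ch_cases m a with h | ⟨x, rfl⟩
    · rw [h] at he he'
      exact absurd (he.trans he'.symm) hne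
    · obtain ⟨w, rfl, rfl⟩ := (ch_cls _ _ _).1 he
      obtain ⟨w', h1, rfl⟩ := (ch_cls _ _ _).1 he'
      by_contra hn
      obtain ⟨h, ⟨v, ⟨hv1, hv2⟩, rfl⟩, ⟨v', ⟨hv1', hv2'⟩, hv⟩⟩ := Set.nonempty_iff_ne_empty.2 hn
      obtain rfl := Hh_inj hv
      apply hne
      unfold cell
      rw [← hv1, ← hv2, ← hv1', ← hv2']
  no_choice_between_undivided m a e he h h' hh hh' hhe := by
    rintro ⟨m', ⟨hle, hne⟩, h1, h2⟩
    change e ∈ ch m a at he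
    rcases ch_cases m a with hc | ⟨x, rfl⟩
    · rw [hc] at he
      rw [Set.mem_singleton_iff.1 he]
      exact hh'
    · obtain ⟨w, hw, rfl⟩ := (hm_cls _ _).1 hh
      obtain ⟨w', hw', rfl⟩ := (hm_cls _ _).1 hh'
      change tle (.cls x) m' at hle
      cases m' with
      | root => exact hle.elim
      | cls y => exact absurd (congrArg Tr.cls hle) hne
      | leaf v =>
        obtain rfl := (leaf_mem_Hh _ _).1 h1
        obtain rfl := (leaf_mem_Hh _ _).1 h2
        exact hhe
  independence m f hf := by
    change ∀ a, f a ∈ ch m a at hf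
    by_cases hx : ∃ x, m = .cls x
    · obtain ⟨x, rfl⟩ := hx
      obtain ⟨w0, rfl⟩ := qr_surj x
      choose g hg1 hg2 using fun a => (ch_cls _ _ _).1 (hf a)
      obtain ⟨w, hw1, hw2⟩ := indep w0 g (fun a => qr_eq.1 (hg1 a))
      refine ⟨Hh w, Set.mem_iInter.2 fun a => ?_⟩
      rw [hg2]
      exact ⟨w, ⟨(qr_eq.2 hw1).trans (hg1 a).symm, hw2 a⟩, rfl⟩
    · obtain ⟨h, hh⟩ := hm_ne m
      refine ⟨h, Set.mem_iInter.2 fun a => ?_⟩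
      have h1 := (ch_cases m a).resolve_right hx
      have h2 := hf a
      rw [h1] at h2
      rw [Set.mem_singleton_iff.1 h2]
      exact hh

theorem cell_pre (w : W Agent) (a : Agent) (h : Set (Tr Agent)) :
    h ∈ (pre Agent).Cell (.cls (qr w)) a (Hh w) ↔
      ∃ w', qf w' = qf w ∧ kf a w' = kf a w ∧ h = Hh w' := by
  constructor
  · rintro ⟨e, ⟨v, hv, rfl⟩, ⟨u, ⟨hu1, hu2⟩, hu⟩, ⟨w', ⟨h1, h2⟩, rfl⟩⟩
    obtain rfl := Hh_inj hu
    exact ⟨w', (qr_eq.1 h1).trans (qr_eq.1 hu1).symm, h2.trans hu2.symm, rfl⟩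
  · rintro ⟨w', h1, h2, rfl⟩
    exact ⟨_, ⟨w, rfl, rfl⟩, ⟨w, ⟨rfl, rfl⟩, rfl⟩, ⟨w', ⟨qr_eq.2 h1, h2⟩, rfl⟩⟩

theorem kq (a : Agent) {w w' : W Agent} (h : kf a w = kf a w') : qf w = qf w' := by
  have hv : ∀ (v : W Agent) (A : Form Agent), A.box ∈ v → Form.cstit a A.box ∈ v := by
    intro v A hA
    refine v.cl1 hA fun p hp => ((s5C a).sat _ _).2 fun q hq => (s5S.sat _ _).2 fun r hr => ?_
    refine (s5S.sat _ _).1 hp r ?_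
    cases hq; cases hr; exact ⟨_, _, _, _, _, _⟩
  have key : ∀ v v' : W Agent, kf a v = kf a v' → qf v ⊆ qf v' := by
    intro v v' hh A hA
    have h1 : A.box ∈ kf a v := hv v A hA
    rw [hh] at h1
    exact op_T (s5C a) _ h1
  exact (key _ _ h).antisymm (key _ _ h.symm)

theorem imag_congr (w : W Agent) (a : Agent) {A B : Form Agent}
    (h : ∀ v : W Agent, A ∈ v ↔ B ∈ v) (hA : Form.imag a A ∈ w) : Form.imag a B ∈ w := by
  have hAB : ∀ p : Pt Agent, T p A ↔ T p B := by
    intro p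
    obtain ⟨v, hv⟩ := ptW p
    rw [← hv, ← hv, h]
  refine w.cl1 hA fun p hp => ?_
  have : {x : p.M.Tree × Set p.M.Tree | p.M.IsHist x.2 ∧ x.1 ∈ x.2 ∧ p.M.Sat A x.1 x.2} =
      {x | p.M.IsHist x.2 ∧ x.1 ∈ x.2 ∧ p.M.Sat B x.1 x.2} := by
    ext x
    constructor
    · rintro ⟨h1, h2, h3⟩
      exact ⟨h1, h2, (hAB ⟨p.M, x.1, x.2, h1, h2⟩).1 h3⟩
    · rintro ⟨h1, h2, h3⟩
      exact ⟨h1, h2, (hAB ⟨p.M, x.1, x.2, h1, h2⟩).2 h3⟩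
  simp only [T, PreModel.Sat] at hp ⊢
  rw [← this]
  exact hp

theorem imag_c (w : W Agent) (a : Agent) {A : Form Agent} (hA : Form.imag a A ∈ w) :
    Form.cstit a (.imag a A) ∈ w := by
  refine w.cl1 hA fun p hp => ?_
  intro h' hh'
  exact ⟨fun h2 hh2 => hp.1 h2 (cell_trans _ hh' hh2), hp.2⟩

theorem imag_nbox (w : W Agent) (a : Agent) {A : Form Agent} (hA : Form.imag a A ∈ w) :
    (Form.imag a A).box ∉ w := by
  rw [← W.neg]
  refine w.cl1 hA fun p hp => ?_
  obtain ⟨h2, hh2, hn⟩ := hp.2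
  intro hb
  exact hn ((hb h2 hh2).1 h2 (cell_refl _ _ hh2))

theorem truth [Nonempty (W Agent)] (A : Form Agent) : ∀ w : W Agent,
    A ∈ w ↔ (pre Agent).Sat A (.cls (qr w)) (Hh w) := by
  induction A with
  | var n =>
    intro w
    constructor
    · intro h; exact ⟨w, rfl, h⟩
    · rintro ⟨v, hv, h⟩
      obtain rfl := Hh_inj (Prod.ext_iff.1 hv).2
      exact h
  | fls => intro w; exact ⟨fun h => w.fls h, fun h => h.elim⟩
  | imp A B ihA ihB =>
    intro w
    rw [W.imp, ihA, ihB]; rfl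
  | box A ih =>
    intro w
    constructor
    · intro h h' hh'
      obtain ⟨w', hw', rfl⟩ := (hm_cls _ _).1 hh'
      rw [← hw', ← ih]
      have : A ∈ qf w := h
      rw [← qr_eq.1 hw'] at this
      exact op_T s5S _ this
    · intro h
      by_contra hn
      obtain ⟨w', h1, h2⟩ := op_ex s5S w hn
      have h3 : qr w' = qr w := qr_eq.2 (by ext B; exact (h2 B).symm)
      refine h1 ((ih w').2 ?_)
      rw [h3]
      exact h _ ((hm_cls _ _).2 ⟨w', h3, rfl⟩)
  | cstit a A ih =>
    intro w
    constructor
    · intro h h' hh'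
      obtain ⟨w', hw', hk, rfl⟩ := (cell_pre _ _ _).1 hh'
      rw [← qr_eq.2 hw', ← ih]
      have : A ∈ kf a w := h
      rw [← hk] at this
      exact op_T (s5C a) _ this
    · intro h
      by_contra hn
      obtain ⟨w', h1, h2⟩ := op_ex (s5C a) w hn
      have h4 : kf a w' = kf a w := by ext B; exact (h2 B).symm
      have h3 := kq a h4
      refine h1 ((ih w').2 ?_)
      rw [qr_eq.2 h3]
      exact h _ ((cell_pre _ _ _).2 ⟨w', h3, h4, rfl⟩)
  | imag a A ih =>
    have hP : ∀ v : W Agent, ((Tr.cls (qr v), Hh v) : Tr Agent × Set (Tr Agent)) ∈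
        {p : (pre Agent).Tree × Set (pre Agent).Tree |
          (pre Agent).IsHist p.2 ∧ p.1 ∈ p.2 ∧ (pre Agent).Sat A p.1 p.2} ↔ A ∈ v := by
      intro v
      rw [ih]
      exact ⟨fun h => h.2.2,
        fun h => ⟨(hist_iff _).2 ⟨v, rfl⟩, (cls_mem_Hh _ _).2 rfl, h⟩⟩
    have hN : ∀ v : W Agent, {p : (pre Agent).Tree × Set (pre Agent).Tree |
          (pre Agent).IsHist p.2 ∧ p.1 ∈ p.2 ∧ (pre Agent).Sat A p.1 p.2} ∈
          (pre Agent).N a (.cls (qr v)) (Hh v) ↔ Form.imag a A ∈ v := by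
      intro v
      constructor
      · rintro ⟨u, _, hu, B, hB, hB2⟩
        obtain rfl := Hh_inj hu
        exact imag_congr v a (fun u => (hB2 u).symm.trans (hP u)) hB
      · intro h
        exact ⟨v, rfl, rfl, A, h, hP⟩
    intro w
    constructor
    · intro h
      constructor
      · intro h' hh'
        obtain ⟨w', hw', hk, rfl⟩ := (cell_pre _ _ _).1 hh'
        rw [← qr_eq.2 hw', hN]
        have : Form.imag a A ∈ kf a w := imag_c w a h
        rw [← hk] at this
        exact op_T (s5C a) _ this
      · obtain ⟨w', h1, h2⟩ := op_ex s5S w (imag_nbox w a h)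
        have h3 : qr w' = qr w := qr_eq.2 (by ext B; exact (h2 B).symm)
        refine ⟨Hh w', (hm_cls _ _).2 ⟨w', h3, rfl⟩, ?_⟩
        rw [← h3, hN]
        exact h1
    · intro h
      exact (hN w).1 (h.1 _ ((cell_pre _ _ _).2 ⟨w, rfl, rfl, rfl⟩))

end Cpt

/-- Semantic compactness: if every finite subset of Θ has a model,
    then Θ has a model. -/
theorem compactness (Agent : Type) [Fintype Agent] (Θ : Set (Form Agent))
    (hfin : ∀ Θ₀ : Set (Form Agent), Θ₀ ⊆ Θ → Θ₀.Finite →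
      ∃ (M : IModel Agent) (m : M.Tree) (h : Set M.Tree),
        h ∈ M.toPreModel.Hm m ∧ ∀ A ∈ Θ₀, M.toPreModel.Sat A m h) :
    ∃ (M : IModel Agent) (m : M.Tree) (h : Set M.Tree),
      h ∈ M.toPreModel.Hm m ∧ ∀ A ∈ Θ, M.toPreModel.Sat A m h := by
  have hFS : Cpt.FS Θ := by
    intro F hF hFf
    obtain ⟨M, m, h, hh, H⟩ := hfin F hF hFf
    exact ⟨⟨M, m, h, hh⟩, H⟩
  obtain ⟨w, hw⟩ := Cpt.lind hFS
  have : Nonempty (Cpt.W Agent) := ⟨w⟩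
  exact ⟨Cpt.can Agent, Cpt.Tr.cls (Cpt.qr w), Cpt.Hh w, (Cpt.hm_cls _ _).2 ⟨w, rfl, rfl⟩,
    fun A hA => (Cpt.truth A w).1 (hw A hA)⟩
end

section
/- Lemma on Independence: the canonical model satisfies independence of agents, i.e., for every moment m of the canonical Tree and every function f on Ag with f(a) ∈ Choice^a_m for all a ∈ Ag, the intersection ⋂_{a ∈ Ag} f(a) is nonempty. -/
set_option maxHeartbeats 1000000

section Aux

variable {Agent : Type}

def BVal (v : Form Agent → Prop) : Prop :=
  ¬ v .fls ∧ ∀ B C : Form Agent, v (B.imp C) ↔ (v B → v C)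

theorem BVal.neg {v : Form Agent → Prop} (h : BVal v) (A : Form Agent) : v A.neg ↔ ¬ v A := by
  have h1 := h.1
  have h2 := h.2 A .fls
  unfold Form.neg
  tauto

theorem BVal.conj {v : Form Agent → Prop} (h : BVal v) (A B : Form Agent) :
    v (A.conj B) ↔ (v A ∧ v B) := by
  unfold Form.conj
  rw [h.neg, h.2, h.neg]
  tauto

theorem BVal.listConj {v : Form Agent → Prop} (h : BVal v) (l : List (Form Agent)) :
    v (listConj l) ↔ ∀ A ∈ l, v A := by
  induction l with
  | nil =>
    simp only [_root_.listConj, Form.verum]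
    rw [h.neg]
    simp [h.1]
  | cons A l ih =>
    simp only [_root_.listConj]
    rw [h.conj, ih]
    simp

theorem Prov.ofVal {A : Form Agent} (h : ∀ v : Form Agent → Prop, BVal v → v A) : Prov A :=
  Prov.taut fun v h1 h2 => h v ⟨h1, h2⟩

theorem mcs_closed {w : Set (Form Agent)} (hw : MaxConsistent w) {l : List (Form Agent)}
    (hl : ∀ A ∈ l, A ∈ w) {A : Form Agent} (hA : Prov ((listConj l).imp A)) : A ∈ w := by
  classical
  have hc : Consistent (insert A w) := by
    rintro ⟨l2, h2, hp⟩
    refine hw.1 ⟨l ++ l2.filter (fun B => B ≠ A), ?_, ?_⟩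
    · intro B hB
      rw [List.mem_append, List.mem_filter] at hB
      rcases hB with hB | ⟨hB, hne⟩
      · exact hl B hB
      · rcases h2 B hB with h | h
        · simp [h] at hne
        · exact h
    · refine Prov.mp (Prov.mp (Prov.ofVal ?_) hA) hp
      intro v hv
      simp only [hv.2, hv.listConj, hv.1, List.mem_append, List.mem_filter]
      intro h3 h4 h5
      have h6 := h3 fun B hB => h5 B (Or.inl hB)
      refine h4 fun B hB => ?_
      by_cases hBA : B = A
      · rw [hBA]; exact h6
      · exact h5 B (Or.inr ⟨hB, by simpa using hBA⟩)
  rw [← hw.2 _ hc (Set.subset_insert _ _)]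
  exact Set.mem_insert _ _

theorem mcs_prov {w : Set (Form Agent)} (hw : MaxConsistent w) {A : Form Agent}
    (h : Prov A) : A ∈ w := by
  refine mcs_closed hw (l := []) (by simp) (Prov.mp (Prov.ofVal ?_) h)
  intro v hv
  simp only [hv.2]
  tauto

theorem mcs_mp {w : Set (Form Agent)} (hw : MaxConsistent w) {A B : Form Agent}
    (h : A.imp B ∈ w) (hA : A ∈ w) : B ∈ w := by
  refine mcs_closed hw (l := [A.imp B, A]) (by simp [h, hA]) (Prov.ofVal ?_)
  intro v hv
  simp only [hv.2, hv.listConj]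
  intro h1
  have h2 := h1 (A.imp B) (by simp)
  rw [hv.2] at h2
  exact h2 (h1 A (by simp))

theorem mcs_fls {w : Set (Form Agent)} (hw : MaxConsistent w) : Form.fls ∉ w := by
  intro h
  refine hw.1 ⟨[.fls], by simp [h], Prov.ofVal ?_⟩
  intro v hv
  simp only [hv.2, hv.listConj]
  intro h1
  exact h1 _ (by simp)

theorem mcs_neg {w : Set (Form Agent)} (hw : MaxConsistent w) {A : Form Agent}
    (h : A ∉ w) : A.neg ∈ w := by
  classical
  have hc : ¬ Consistent (insert A w) := by
    intro hc
    apply h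
    rw [← hw.2 _ hc (Set.subset_insert _ _)]
    exact Set.mem_insert _ _
  unfold Consistent at hc
  push Not at hc
  obtain ⟨l, hl, hp⟩ := hc
  refine mcs_closed hw (l := l.filter (fun B => B ≠ A)) ?_ (Prov.mp (Prov.ofVal ?_) hp)
  · intro B hB
    rw [List.mem_filter] at hB
    rcases hl B hB.1 with h | h
    · simp [h] at hB
    · exact h
  · intro v hv
    simp only [hv.2, hv.listConj, hv.1, hv.neg, List.mem_filter]
    intro h4 h5 h6
    refine h4 fun B hB => ?_
    by_cases hBA : B = A
    · rw [hBA]; exact h6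
    · exact h5 B ⟨hB, by simpa using hBA⟩

theorem mcs_val {w : Set (Form Agent)} (hw : MaxConsistent w) : BVal (fun A => A ∈ w) := by
  refine ⟨mcs_fls hw, fun B C => ⟨fun h hB => mcs_mp hw h hB, fun h => ?_⟩⟩
  by_cases hB : B ∈ w
  · refine mcs_mp hw (mcs_prov hw (Prov.ofVal ?_)) (h hB)
    intro v hv
    simp only [hv.2]
    tauto
  · refine mcs_mp hw (mcs_prov hw (Prov.ofVal ?_)) (mcs_neg hw hB)
    intro v hv
    simp only [hv.2, hv.neg]
    tauto

theorem lindenbaum {Γ : Set (Form Agent)} (h : Consistent Γ) :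
    ∃ w, Γ ⊆ w ∧ MaxConsistent w := by
  obtain ⟨w, hw, hm⟩ := zorn_subset_nonempty {S : Set (Form Agent) | Consistent S} (by
    intro c hc hch hne
    refine ⟨⋃₀ c, ?_, fun s hs => Set.subset_sUnion_of_mem hs⟩
    rintro ⟨l, hl, hp⟩
    have key : ∀ l : List (Form Agent), (∀ A ∈ l, A ∈ ⋃₀ c) → ∃ s ∈ c, ∀ A ∈ l, A ∈ s := by
      intro l
      induction l with
      | nil => intro _; obtain ⟨s, hs⟩ := hne; exact ⟨s, hs, by simp⟩
      | cons A l ih =>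
        intro hl
        obtain ⟨s, hs, h1⟩ := ih fun B hB => hl B (List.mem_cons_of_mem _ hB)
        obtain ⟨t, ht, h2⟩ := hl A (by simp)
        rcases hch.total hs ht with hst | hst
        · refine ⟨t, ht, ?_⟩
          intro B hB
          rcases List.mem_cons.1 hB with rfl | hB
          · exact h2
          · exact hst (h1 B hB)
        · refine ⟨s, hs, ?_⟩
          intro B hB
          rcases List.mem_cons.1 hB with rfl | hB
          · exact hst h2
          · exact h1 B hB
    obtain ⟨s, hs, h1⟩ := key l hl
    exact hc hs ⟨l, h1, hp⟩) Γ h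
  refine ⟨w, hw, hm.prop, fun S hS hwS => ?_⟩
  exact Set.Subset.antisymm (hm.le_of_ge hS hwS) hwS

theorem prov_of_mcs {A : Form Agent} (h : ∀ w, MaxConsistent w → A ∈ w) : Prov A := by
  by_contra hA
  have hc : Consistent ({A.neg} : Set (Form Agent)) := by
    rintro ⟨l, hl, hp⟩
    refine hA (Prov.mp (Prov.ofVal ?_) hp)
    intro v hv
    simp only [hv.2, hv.listConj, hv.1]
    intro h1
    by_contra h2
    refine h1 fun B hB => ?_
    rw [Set.mem_singleton_iff.1 (hl B hB), hv.neg]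
    exact h2
  obtain ⟨w, hw, hm⟩ := lindenbaum hc
  exact ((mcs_val hm).neg A).1 (hw rfl) (h w hm)

theorem op_listConj {w : Set (Form Agent)} (hw : MaxConsistent w) (O : Form Agent → Form Agent)
    (hN : ∀ A, Prov A → Prov (O A)) (hK : ∀ A B, Prov ((O (A.imp B)).imp ((O A).imp (O B))))
    (l : List (Form Agent)) (h : ∀ A ∈ l, O A ∈ w) : O (listConj l) ∈ w := by
  induction l with
  | nil =>
    refine mcs_prov hw (hN _ (Prov.ofVal fun v hv => ?_))
    rw [hv.listConj]; simp
  | cons A l ih =>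
    have h1 := ih fun B hB => h B (List.mem_cons_of_mem _ hB)
    have h2 := h A (by simp)
    have h3 : Prov (A.imp ((listConj l).imp (listConj (A :: l)))) := by
      refine Prov.ofVal fun v hv => ?_
      simp only [listConj, hv.2, hv.conj]
      tauto
    exact mcs_mp hw (mcs_mp hw (mcs_prov hw (hK _ _))
      (mcs_mp hw (mcs_mp hw (mcs_prov hw (hK _ _)) (mcs_prov hw (hN _ h3))) h2)) h1

theorem joint_consistent [Fintype Agent] [Nonempty Agent] {w0 : Set (Form Agent)}
    (h0 : MaxConsistent w0) (u : Agent → Set (Form Agent)) (hu : ∀ a, u a ∈ RCls w0) :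
    Consistent {A : Form Agent | A.box ∈ w0 ∨ ∃ a, Form.cstit a A ∈ u a} := by
  classical
  rintro ⟨l, hl, hp⟩
  let l0 := l.filter (fun A => A.box ∈ w0)
  let B : Agent → Form Agent := fun a => listConj (l.filter (fun A => Form.cstit a A ∈ u a))
  let L : List (Agent × Form Agent) := (Finset.univ : Finset Agent).toList.map fun a => (a, B a)
  have hL0 : (listConj l0).box ∈ w0 := by
    refine op_listConj h0 Form.box (fun _ h => h.necS) Prov.sK l0 ?_
    intro A hA
    simpa using (List.mem_filter.1 hA).2
  have hB : ∀ a, Form.cstit a (B a) ∈ u a := by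
    intro a
    refine op_listConj (hu a).1 (Form.cstit a) (fun _ h => (Prov.a3 a _).mp h.necS)
      (Prov.cK a) _ ?_
    intro A hA
    simpa using (List.mem_filter.1 hA).2
  have hP : ∀ a, (Form.cstit a (B a)).pos ∈ w0 := by
    intro a
    unfold Form.pos
    refine ((mcs_val h0).neg _).2 fun h => ?_
    exact ((mcs_val (hu a).1).neg _).1 ((hu a).2 _ h) (hB a)
  have hne : L ≠ [] := by
    simp [L, Finset.univ_nonempty.ne_empty]
  have hnd : (L.map Prod.fst).Nodup := by
    have : L.map Prod.fst = (Finset.univ : Finset Agent).toList := by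
      simp [L, Function.comp_def]
    rw [this]
    exact Finset.nodup_toList _
  have h4 : (listConj (L.map fun p => Form.cstit p.1 p.2)).pos ∈ w0 := by
    refine mcs_mp h0 (mcs_prov h0 (Prov.a4 L hne hnd)) (((mcs_val h0).listConj _).2 ?_)
    intro A hA
    simp only [L, List.map_map, List.mem_map] at hA
    obtain ⟨a, -, rfl⟩ := hA
    exact hP a
  have h5 : Prov ((listConj l0).imp (listConj (L.map fun p => Form.cstit p.1 p.2)).neg) := by
    refine prov_of_mcs fun v hv => ?_
    have hb := mcs_val hv
    refine (hb.2 _ _).2 fun h6 => (hb.neg _).2 fun h7 => ?_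
    have h6 := (hb.listConj _).1 h6
    have h7 := (hb.listConj _).1 h7
    refine mcs_fls hv (mcs_mp hv (mcs_prov hv hp) ((hb.listConj _).2 fun A hA => ?_))
    rcases hl A hA with h | ⟨a, h⟩
    · exact h6 A (List.mem_filter.2 ⟨hA, by simpa using h⟩)
    · have h8 : Form.cstit a (B a) ∈ v := h7 _ (by
        simp only [L, List.map_map, List.mem_map]
        exact ⟨a, by simp, rfl⟩)
      have h9 := mcs_mp hv (mcs_prov hv (Prov.cT a (B a))) h8
      exact (hb.listConj _).1 h9 A (List.mem_filter.2 ⟨hA, by simpa using h⟩)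
  have h6 := mcs_mp h0 (mcs_mp h0 (mcs_prov h0 (Prov.sK _ _)) (mcs_prov h0 h5.necS)) hL0
  exact ((mcs_val h0).neg _).1 h4 h6

end Aux

/-- Lemma on Independence: the canonical model satisfies
    independence of agents. -/
theorem canonical_independence (Agent : Type) [Fintype Agent] (m : CTree Agent)
    (f : Agent → Set (Set (CTree Agent))) (hf : ∀ a, f a ∈ CChoice m a) :
    (⋂ a, f a).Nonempty := by
  rcases isEmpty_or_nonempty Agent with hE | hE
  · exact ⟨∅, by simp⟩
  by_cases hm : IsClsMoment m
  · obtain ⟨X, hX⟩ := hm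
    have hXi : X ∈ Xi Agent := by
      rcases m.2 with h | ⟨Y, hY, h⟩ | ⟨w, hw, h⟩
      · rw [hX] at h; cases h
      · rw [hX] at h; cases h; exact hY
      · rw [hX] at h; cases h
    obtain ⟨w0, h0, rfl⟩ := hXi
    have hf' : ∀ a, ∃ w ∈ RCls w0,
        f a = {h | ∃ w' ∈ {w' ∈ RCls w0 | CanC a w w'}, h = CHistX (RCls w0) w'} := by
      intro a
      rcases hf a with ⟨h, -⟩ | ⟨Y, hY, e, ⟨w, hw, rfl⟩, h⟩
      · exact absurd ⟨_, hX⟩ h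
      · rw [hX] at hY; cases hY; exact ⟨w, hw, h⟩
    choose u hu hfu using hf'
    obtain ⟨w, hw, hmc⟩ := lindenbaum (joint_consistent h0 u hu)
    refine ⟨CHistX (RCls w0) w, Set.mem_iInter.2 fun a => ?_⟩
    rw [hfu a]
    exact ⟨w, ⟨⟨hmc, fun A hA => hw (Or.inl hA)⟩, fun A hA => hw (Or.inr ⟨a, hA⟩)⟩, rfl⟩
  · obtain ⟨h, hh, hmh⟩ := (IsChain.singleton (r := CLe) (a := m)).exists_maxChain
    refine ⟨h, Set.mem_iInter.2 fun a => ?_⟩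
    rcases hf a with ⟨-, h1⟩ | ⟨Y, hY, -⟩
    · rw [h1]; exact ⟨hh, hmh rfl⟩
    · exact absurd ⟨Y, hY⟩ hm
end

section
/- (F1, uniqueness part) There exists exactly one L-maxiconsistent set extending Σ = {¬p : p ∈ Var} ∪ {SA ↔ A : A a sentence} ∪ {[c]_aA ↔ A : A a sentence, a ∈ Ag}. -/
set_option maxHeartbeats 1000000

def valF {Agent : Type} : Form Agent → Prop
  | .var _ => False
  | .fls => False
  | .imp A B => valF A → valF B
  | .box A => valF A
  | .cstit _ A => valF A
  | .imag _ _ => False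

theorem v_neg {Agent : Type} {v : Form Agent → Prop} (h0 : ¬ v .fls)
    (h1 : ∀ B C : Form Agent, v (B.imp C) ↔ (v B → v C)) (A : Form Agent) :
    v A.neg ↔ ¬ v A := by
  simp [Form.neg, h1, h0]

theorem v_conj {Agent : Type} {v : Form Agent → Prop} (h0 : ¬ v .fls)
    (h1 : ∀ B C : Form Agent, v (B.imp C) ↔ (v B → v C)) (A B : Form Agent) :
    v (A.conj B) ↔ (v A ∧ v B) := by
  simp [Form.conj, Form.neg, h1, h0]

theorem v_fiff {Agent : Type} {v : Form Agent → Prop} (h0 : ¬ v .fls)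
    (h1 : ∀ B C : Form Agent, v (B.imp C) ↔ (v B → v C)) (A B : Form Agent) :
    v (A.fiff B) ↔ (v A ↔ v B) := by
  rw [Form.fiff, v_conj h0 h1, h1, h1]; tauto

theorem v_list {Agent : Type} {v : Form Agent → Prop} (h0 : ¬ v .fls)
    (h1 : ∀ B C : Form Agent, v (B.imp C) ↔ (v B → v C)) (l : List (Form Agent)) :
    v (listConj l) ↔ ∀ A ∈ l, v A := by
  induction l with
  | nil => simp [listConj, Form.verum, v_neg h0 h1, h0]
  | cons A l ih => simp [listConj, v_conj h0 h1, ih]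

theorem valF0 {Agent : Type} : ¬ valF (.fls : Form Agent) := fun h => h

theorem valF1 {Agent : Type} (B C : Form Agent) : valF (B.imp C) ↔ (valF B → valF C) := Iff.rfl

theorem valF_sound {Agent : Type} {A : Form Agent} (h : Prov A) : valF A := by
  induction h with
  | taut h => exact h _ valF0 valF1
  | sK A B => exact fun h => h
  | sT A => exact fun h => h
  | s5 A => exact fun h => h
  | cK a A B => exact fun h => h
  | cT a A => exact fun h => h
  | c5 a A => exact fun h => h
  | a3 a A => exact fun h => h
  | a4 l _ _ =>
    have hp : ∀ A : Form Agent, valF A.pos ↔ valF A := fun A => by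
      simp [Form.pos, Form.neg, valF]
    rw [valF1, hp, v_list valF0 valF1, v_list valF0 valF1]
    intro h A hA
    obtain ⟨p, hpl, rfl⟩ := List.mem_map.1 hA
    exact (hp _).1 (h _ (List.mem_map.2 ⟨p, hpl, rfl⟩))
  | a5 a A => exact fun h => h.elim
  | mp _ _ h1 h2 => exact h1 h2
  | necS _ h => exact h
  | reI a _ _ => rw [v_fiff valF0 valF1]; exact Iff.rfl

def DerS {Agent : Type} (A : Form Agent) : Prop :=
  ∃ l : List (Form Agent), (∀ B ∈ l, B ∈ SigmaSet Agent) ∧ Prov ((listConj l).imp A)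

theorem DerS.of_prov {Agent : Type} {A : Form Agent} (h : Prov A) : DerS A :=
  ⟨[], by simp, .mp (.taut fun v h0 h1 => by simp only [h1]; tauto) h⟩

theorem DerS.of_mem {Agent : Type} {A : Form Agent} (h : A ∈ SigmaSet Agent) : DerS A :=
  ⟨[A], by simpa using h, .taut fun v h0 h1 => by rw [h1, v_list h0 h1]; simp⟩

theorem DerS.mp {Agent : Type} {A B : Form Agent} (h : DerS (A.imp B)) (h' : DerS A) :
    DerS B := by
  obtain ⟨l, hl, p⟩ := h
  obtain ⟨l', hl', p'⟩ := h'
  refine ⟨l ++ l', ?_, ?_⟩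
  · intro B hB
    rcases List.mem_append.1 hB with h | h
    exacts [hl _ h, hl' _ h]
  · refine .mp (.mp (.taut fun v h0 h1 => ?_) p) p'
    simp only [h1, v_list h0 h1, List.mem_append]
    intro a b c
    exact a (fun A h => c A (.inl h)) (b fun A h => c A (.inr h))

theorem DerS.taut1 {Agent : Type} {A B : Form Agent} (h' : DerS A)
    (h : Tautology (A.imp B)) : DerS B := (DerS.of_prov (.taut h)).mp h'

theorem DerS.taut2 {Agent : Type} {A B C : Form Agent} (h' : DerS A) (h'' : DerS B)
    (h : Tautology (A.imp (B.imp C))) : DerS C := (h'.taut1 h).mp h''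

theorem derS_dec {Agent : Type} (A : Form Agent) :
    (valF A → DerS A) ∧ (¬ valF A → DerS A.neg) := by
  have key : ∀ A B : Form Agent, DerS (A.fiff B) →
      (valF B → DerS B) ∧ (¬ valF B → DerS B.neg) →
      (valF B → DerS A) ∧ (¬ valF B → DerS A.neg) := by
    intro A B h ih
    refine ⟨fun hv => h.taut2 (ih.1 hv) fun v h0 h1 => ?_,
      fun hv => h.taut2 (ih.2 hv) fun v h0 h1 => ?_⟩
    · simp only [h1, v_fiff h0 h1]; tauto
    · simp only [h1, v_fiff h0 h1, v_neg h0 h1]; tauto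
  induction A with
  | var n => exact ⟨fun h => h.elim, fun _ => .of_mem (.inl ⟨n, rfl⟩)⟩
  | fls =>
    refine ⟨fun h => h.elim, fun _ => .of_prov (.taut fun v h0 h1 => ?_)⟩
    rw [v_neg h0 h1]; exact h0
  | imp A B ihA ihB =>
    constructor
    · intro h
      by_cases hA : valF A
      · refine (ihB.1 (h hA)).taut1 fun v h0 h1 => ?_
        simp only [h1]; tauto
      · refine (ihA.2 hA).taut1 fun v h0 h1 => ?_
        simp only [h1, v_neg h0 h1]; tauto
    · intro h
      rw [valF1, Classical.not_imp] at h
      refine (ihA.1 h.1).taut2 (ihB.2 h.2) fun v h0 h1 => ?_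
      simp only [h1, v_neg h0 h1]; tauto
  | box A ih => exact key _ A (.of_mem (.inr (.inl ⟨A, rfl⟩))) ih
  | cstit a A ih => exact key _ A (.of_mem (.inr (.inr ⟨a, A, rfl⟩))) ih
  | imag a A ih =>
    refine ⟨fun h => h.elim, fun _ => ?_⟩
    refine (DerS.of_mem (.inr (.inl ⟨.imag a A, rfl⟩))).taut2 (.of_prov (.a5 a A))
      fun v h0 h1 => ?_
    simp only [h1, v_neg h0 h1, v_conj h0 h1, v_fiff h0 h1]; tauto

/-- F1, uniqueness part: there is exactly one L-maxiconsistent set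
    extending Σ. -/
theorem sigma_unique_mcs (Agent : Type) [Fintype Agent] :
    ∃! w : Set (Form Agent), MaxConsistent w ∧ SigmaSet Agent ⊆ w := by
  have hc : Consistent {A : Form Agent | valF A} := by
    rintro ⟨l, hl, p⟩
    exact valF_sound p ((v_list valF0 valF1 l).2 hl)
  refine ⟨{A | valF A}, ⟨⟨hc, ?_⟩, ?_⟩, ?_⟩
  · intro Γ hΓ hs
    refine Set.Subset.antisymm (fun A hA => ?_) hs
    by_contra hv
    refine hΓ ⟨[A, A.neg], ?_, .taut fun v h0 h1 => ?_⟩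
    · intro B hB
      simp only [List.mem_cons, List.not_mem_nil, or_false] at hB
      rcases hB with rfl | rfl
      · exact hA
      · exact hs ((v_neg valF0 valF1 _).2 hv)
    · rw [h1, v_list h0 h1]
      simp [v_neg h0 h1]
  · rintro A (⟨n, rfl⟩ | ⟨A, rfl⟩ | ⟨a, A, rfl⟩)
    · exact fun h => h
    · exact (v_fiff valF0 valF1 _ _).2 Iff.rfl
    · exact (v_fiff valF0 valF1 _ _).2 Iff.rfl
  · rintro w ⟨⟨hw, hm⟩, hs⟩
    refine (hm _ hc fun A hA => ?_).symm
    by_contra hv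
    obtain ⟨l, hl, p⟩ := (derS_dec A).2 hv
    refine hw ⟨A :: l, ?_, .mp (.taut fun v h0 h1 => ?_) p⟩
    · intro B hB
      rcases List.mem_cons.1 hB with rfl | h
      exacts [hA, hs (hl _ h)]
    · simp only [h1, v_list h0 h1, v_neg h0 h1, List.mem_cons, forall_eq_or_imp]
      tauto
end

section
/- Every L-maxiconsistent set w extending Σ = {¬p : p ∈ Var} ∪ {SA ↔ A} ∪ {[c]_aA ↔ A} contains ¬I_aA for every sentence A and every agent a ∈ Ag. -/
set_option maxHeartbeats 1000000

theorem listConj_val {Agent : Type} (v : Form Agent → Prop) (h0 : ¬ v .fls)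
    (hi : ∀ B C : Form Agent, v (B.imp C) ↔ (v B → v C)) (l : List (Form Agent)) :
    v (listConj l) ↔ ∀ B ∈ l, v B := by
  induction l with
  | nil => simp [listConj, Form.verum, Form.neg, hi]
  | cons B l ih =>
    simp only [listConj, Form.conj, Form.neg, hi, ih, List.forall_mem_cons]
    tauto

/-- every L-maxiconsistent set extending Σ contains ¬I_aA for every
    sentence A and agent a. -/
theorem sigma_mcs_refutes_imagination (Agent : Type) [Fintype Agent]
    (w : Set (Form Agent)) (hw : MaxConsistent w) (hSig : SigmaSet Agent ⊆ w)
    (a : Agent) (A : Form Agent) :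
    (Form.imag a A).neg ∈ w := by
  classical
  have hc : Consistent (w ∪ {(Form.imag a A).neg}) := by
    rintro ⟨l, hl, hp⟩
    apply hw.1
    refine ⟨((Form.imag a A).box.fiff (Form.imag a A)) :: l.filter (fun B => B ∈ w), ?_, ?_⟩
    · intro B hB
      rcases List.mem_cons.1 hB with rfl | hB
      · exact hSig (Or.inr (Or.inl ⟨_, rfl⟩))
      · simpa using (List.mem_filter.1 hB).2
    · refine Prov.mp (Prov.mp (Prov.taut ?_) (Prov.a5 a A)) hp
      intro v h0 hi
      rw [hi, hi, hi, hi (listConj _), hi (listConj _), listConj_val v h0 hi, listConj_val v h0 hi]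
      intro h5 hl' hall
      have hiff := hall _ List.mem_cons_self
      have hneg : v (Form.imag a A).neg := by
        simp only [Form.fiff, Form.conj, Form.neg, hi] at h5 hiff ⊢
        tauto
      apply hl'
      intro B hB
      rcases hl B hB with h | h
      · exact hall B (List.mem_cons_of_mem _ (List.mem_filter.2 ⟨hB, by simpa using h⟩))
      · rw [Set.mem_singleton_iff.1 h]; exact hneg
  have := hw.2 _ hc Set.subset_union_left
  rw [← this]
  exact Or.inr rfl
end

section
/- The canonical model satisfies 'no choice between undivided histories': for every moment m of the canonical Tree, agent a ∈ Ag, choice cell e ∈ Choice^m_a, and histories h, h' through m, if h ∈ e and there is a moment m' with m < m' and m' ∈ h ∩ h', then h' ∈ e. -/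
set_option maxHeartbeats 1000000

/-- the canonical model satisfies 'no choice between undivided
    histories'. -/
theorem canonical_no_choice_between_undivided (Agent : Type) [Fintype Agent]
    (m : CTree Agent) (a : Agent) (e : Set (Set (CTree Agent))) (he : e ∈ CChoice m a)
    (h h' : Set (CTree Agent))
    (hh : IsMaxChain CLe h ∧ m ∈ h) (hh' : IsMaxChain CLe h' ∧ m ∈ h')
    (hme : h ∈ e) (hdiv : ∃ m', (CLe m m' ∧ m ≠ m') ∧ m' ∈ h ∧ m' ∈ h') :
    h' ∈ e := by
  rcases he with ⟨_, rfl⟩ | ⟨X, hmX, E, hE, rfl⟩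
  · exact hh'
  obtain ⟨w, hwE, rfl⟩ := hme
  obtain ⟨m', ⟨hle, hne⟩, hm'h, hm'h'⟩ := hdiv
  have hm' : m'.1 = some (Sum.inr w) ∧ w ∈ X := by
    rcases hle with h1 | ⟨Y, v, h1, h2, h3⟩ | h1
    · exact absurd h1 hne
    · have hXY : X = Y := by
        have := hmX.symm.trans h1
        injection this with this
        injection this
      subst hXY
      rcases hm'h with h4 | h4 | h4
      · have := h4.symm.trans h2
        cases this
      · have := h4.symm.trans h2
        injection this with this
        cases this
      · have := h4.symm.trans h2
        injection this with this
        injection this with this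
        subst this
        exact ⟨h4, h3⟩
    · have := h1.symm.trans hmX
      cases this
  obtain ⟨hm'w, hwX⟩ := hm'
  have hsub : h' ⊆ CHistX X w := by
    intro x hx
    rcases x.2 with h1 | ⟨Y, _, h1⟩ | ⟨v, _, h1⟩
    · exact Or.inl h1
    · right; left
      by_cases hxm : x = m
      · rw [hxm]; exact hmX
      rcases hh'.1.1 hx hh'.2 hxm with h2 | h2
      · rcases h2 with h2 | ⟨Z, u, h3, h4, _⟩ | h2
        · exact absurd h2 hxm
        · have := h4.symm.trans hmX
          injection this with this
          cases this
        · have := h2.symm.trans h1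
          cases this
      · rcases h2 with h2 | ⟨Z, u, h3, h4, _⟩ | h2
        · exact absurd h2.symm hxm
        · have := h4.symm.trans h1
          injection this with this
          cases this
        · have := h2.symm.trans hmX
          cases this
    · right; right
      by_cases hxm : x = m'
      · rw [hxm]; exact hm'w
      rcases hh'.1.1 hx hm'h' hxm with h2 | h2
      · rcases h2 with h2 | ⟨Z, u, h3, h4, _⟩ | h2
        · exact absurd h2 hxm
        · have := h3.symm.trans h1
          injection this with this
          cases this
        · have := h2.symm.trans h1
          cases this
      · rcases h2 with h2 | ⟨Z, u, h3, h4, _⟩ | h2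
        · exact absurd h2.symm hxm
        · have := h3.symm.trans hm'w
          injection this with this
          cases this
        · have := h2.symm.trans hm'w
          cases this
  exact ⟨w, hwE, hh'.1.2 hh.1.1 hsub⟩
end
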